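/- Let Γ ∈ 𝒰 and suppose that Γ′ : (0,∞) → (0,∞) is a bijection; let γ := (Γ′)^{−1}. Then there exist positive constants β_0 and β_1 such that for all real numbers k and all l ≥ 0: (i) if Γ″ > 0 on (0,∞), then 2^{β_0 l} ≤ γ(2^{k+l})/γ(2^k) ≤ 2^{β_1 l}; (ii) if Γ″ < 0 on (0,∞), then 2^{−β_1 l} ≤ γ(2^{k+l})/γ(2^k) ≤ 2^{−β_0 l}. -/

import Mathlib

open MeasureTheory Filter Set
open scoped ENNReal NNReal FourierTransform Topology

noncomputable section

/-- `ℝⁿ` as a Euclidean space. -/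
abbrev Rn (n : ℕ) := EuclideanSpace ℝ (Fin n)

/-- The class `𝒰` of phase functions: `Γ` is continuous on `[0,∞)`, smooth on `(0,∞)`,
`Γ(0) = 0`, `Γ′ > 0` on `(0,∞)`, with the bounds `c_{1,j} ≤ |s^j Γ^{(j)}(s)/Γ(s)|` for
`j = 1, 2` and `|s^j Γ^{(j)}(s)/Γ(s)| ≤ c_{2,j}` for all `j ≥ 1`. -/
structure IsGammaU (Γ : ℝ → ℝ) : Prop where
  continuousOn : ContinuousOn Γ (Set.Ici 0)
  smooth : ContDiffOn ℝ (⊤ : ℕ∞) Γ (Set.Ioi 0)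
  map_zero : Γ 0 = 0
  deriv_pos : ∀ s > (0 : ℝ), 0 < deriv Γ s
  lower : ∀ j ∈ ({1, 2} : Set ℕ), ∃ c > (0 : ℝ), ∀ s > (0 : ℝ),
    c ≤ |s ^ j * iteratedDeriv j Γ s / Γ s|
  upper : ∀ j : ℕ, 1 ≤ j → ∃ c > (0 : ℝ), ∀ s > (0 : ℝ),
    |s ^ j * iteratedDeriv j Γ s / Γ s| ≤ c

/-- `K` is a homogeneous Calderón–Zygmund kernel on `ℝⁿ`: `K(t) = Ω(t)/‖t‖ⁿ` with `Ω` smooth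
away from the origin, homogeneous of degree `0`, and of mean value zero on the unit sphere. -/
def IsHomCZKernel (n : ℕ) (K : Rn n → ℝ) : Prop :=
  ∃ Ω : Rn n → ℝ,
    ContDiffOn ℝ (⊤ : ℕ∞) Ω {x : Rn n | x ≠ 0} ∧
    (∀ c : ℝ, 0 < c → ∀ t : Rn n, Ω (c • t) = Ω t) ∧
    (∫ θ : Metric.sphere (0 : Rn n) 1, Ω θ ∂((volume : Measure (Rn n)).toSphere) = 0) ∧
    (∀ t : Rn n, t ≠ 0 → K t = Ω t / ‖t‖ ^ n)

/-- The `r`-variation of a family `(a_u)_{u ∈ 𝒦}`. -/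
def variation {ι : Type*} [LinearOrder ι] (r : ℝ) (𝒦 : Set ι) (a : ι → ℂ) : ℝ≥0∞ :=
  ⨆ (J : ℕ) (u : Fin (J + 1) → ι) (_ : StrictMono u) (_ : ∀ i, u i ∈ 𝒦),
    (∑ i : Fin J, (‖a (u i.succ) - a (u i.castSucc)‖₊ : ℝ≥0∞) ^ r) ^ (1 / r)

/-- The `λ`-jump counting function of a family `(a_u)_{u ∈ 𝒦}`. -/
def jumpCount {ι : Type*} [LinearOrder ι] (lam : ℝ) (𝒦 : Set ι) (a : ι → ℂ) : ℝ≥0∞ :=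
  ⨆ (J : ℕ) (s : Fin J → ι) (t : Fin J → ι) (_ : ∀ i, s i ∈ 𝒦) (_ : ∀ i, t i ∈ 𝒦)
    (_ : ∀ i, s i < t i) (_ : ∀ i j : Fin J, i < j → t i < s j)
    (_ : ∀ i, lam < ‖a (t i) - a (s i)‖), (J : ℝ≥0∞)

/-- The `L^p` norm of an `ℝ≥0∞`-valued function. -/
def lpNormENN {α : Type*} [MeasurableSpace α] (p : ℝ) (g : α → ℝ≥0∞) (μ : Measure α) : ℝ≥0∞ :=
  (∫⁻ x, g x ^ p ∂μ) ^ (1 / p)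

/-- If `f' ∈ [A, B]` with `A > 0`, then the increments of the argument of `f` are comparable to
the nonnegative increments of its values. -/
theorem sub_mem_Icc_of_deriv_mem_Icc {f f' : ℝ → ℝ} {A B x y D : ℝ} (hA : 0 < A)
    (hf : ∀ t, HasDerivAt f (f' t) t) (hf' : ∀ t, f' t ∈ Set.Icc A B)
    (hD : 0 ≤ D) (hxy : f y - f x = D) : y - x ∈ Set.Icc (B⁻¹ * D) (A⁻¹ * D) := by
  have hB : 0 < B := hA.trans_le ((hf' 0).1.trans (hf' 0).2)
  have hdiff : Differentiable ℝ f := fun t => (hf t).differentiableAt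
  have lower := mul_sub_le_image_sub_of_le_deriv hdiff (C := A)
    (fun t => (hf t).deriv ▸ (hf' t).1)
  have upper := image_sub_le_mul_sub_of_deriv_le hdiff (C := B)
    (fun t => (hf t).deriv ▸ (hf' t).2)
  have hle : x ≤ y := by
    by_contra! h
    have h₁ := lower h.le
    have h₂ : 0 < A * (x - y) := mul_pos hA (sub_pos.2 h)
    linarith
  rw [Set.mem_Icc, inv_mul_le_iff₀ hB, le_inv_mul_iff₀ hA, ← hxy]
  exact ⟨upper hle, lower hle⟩

theorem two_rpow_mul_le_div_iff {a b β l : ℝ} (ha : 0 < a) (hb : 0 < b) :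
    (2 : ℝ) ^ (β * l) ≤ b / a ↔ β * (l * Real.log 2) ≤ Real.log b - Real.log a := by
  rw [Real.rpow_le_iff_le_log two_pos (div_pos hb ha), Real.log_div hb.ne' ha.ne', mul_assoc]

theorem div_le_two_rpow_mul_iff {a b β l : ℝ} (ha : 0 < a) (hb : 0 < b) :
    b / a ≤ (2 : ℝ) ^ (β * l) ↔ Real.log b - Real.log a ≤ β * (l * Real.log 2) := by
  rw [Real.le_rpow_iff_log_le (div_pos hb ha) two_pos, Real.log_div hb.ne' ha.ne', mul_assoc]

namespace IsGammaU

variable {Γ : ℝ → ℝ}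

theorem hasDerivAt_deriv (hΓ : IsGammaU Γ) {s : ℝ} (hs : 0 < s) :
    HasDerivAt (deriv Γ) (iteratedDeriv 2 Γ s) s := by
  have h : ContDiffOn ℝ 1 (deriv Γ) (Set.Ioi 0) :=
    hΓ.smooth.deriv_of_isOpen isOpen_Ioi (WithTop.coe_le_coe.2 (le_top (a := (1 + 1 : ℕ∞))))
  rw [iteratedDeriv_succ, iteratedDeriv_one]
  exact ((h.contDiffAt (Ioi_mem_nhds hs)).differentiableAt one_ne_zero).hasDerivAt

/-- The logarithmic derivative of `t ↦ Γ'(exp t)`. -/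
theorem hasDerivAt_log_deriv_exp (hΓ : IsGammaU Γ) (t : ℝ) :
    HasDerivAt (fun t => Real.log (deriv Γ (Real.exp t)))
      (iteratedDeriv 2 Γ (Real.exp t) * Real.exp t / deriv Γ (Real.exp t)) t :=
  ((hΓ.hasDerivAt_deriv (Real.exp_pos t)).comp t (Real.hasDerivAt_exp t)).log
    (hΓ.deriv_pos _ (Real.exp_pos t)).ne'

theorem exists_bounds (hΓ : IsGammaU Γ) : ∃ A > (0 : ℝ), ∃ B > (0 : ℝ), ∀ s > (0 : ℝ),
    |iteratedDeriv 2 Γ s * s / deriv Γ s| ∈ Set.Icc A B := by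
  obtain ⟨a₁, ha₁, h₁⟩ := hΓ.lower 1 (by simp)
  obtain ⟨a₂, ha₂, h₂⟩ := hΓ.lower 2 (by simp)
  obtain ⟨b₁, hb₁, h₃⟩ := hΓ.upper 1 le_rfl
  obtain ⟨b₂, hb₂, h₄⟩ := hΓ.upper 2 one_le_two
  refine ⟨a₂ / b₁, div_pos ha₂ hb₁, b₂ / a₁, div_pos hb₂ ha₁, fun s hs => ?_⟩
  have hne : Γ s ≠ 0 := by
    intro h0
    have := h₁ s hs
    rw [h0, div_zero, abs_zero] at this
    linarith
  have hd := (hΓ.deriv_pos s hs).ne'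
  have key : |iteratedDeriv 2 Γ s * s / deriv Γ s| =
      |s ^ 2 * iteratedDeriv 2 Γ s / Γ s| / |s ^ 1 * iteratedDeriv 1 Γ s / Γ s| := by
    rw [← abs_div, iteratedDeriv_one]
    congr 1
    field_simp
  rw [key]
  exact ⟨div_le_div₀ (abs_nonneg _) (h₂ s hs) (ha₁.trans_le (h₁ s hs)) (h₃ s hs),
    div_le_div₀ hb₂.le (h₄ s hs) ha₁ (h₁ s hs)⟩

end IsGammaU

/-- Lemma 2.1: growth estimates for the inverse of `Γ′`. -/
theorem inverse_deriv_growth (Γ : ℝ → ℝ) (hΓ : IsGammaU Γ) (γ : ℝ → ℝ)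
    (hinv₁ : ∀ s > (0 : ℝ), 0 < γ s ∧ deriv Γ (γ s) = s)
    (hinv₂ : ∀ s > (0 : ℝ), γ (deriv Γ s) = s) :
    ∃ β₀ > (0 : ℝ), ∃ β₁ > (0 : ℝ), ∀ k l : ℝ, 0 ≤ l →
      ((∀ s > (0 : ℝ), 0 < iteratedDeriv 2 Γ s) →
        (2 : ℝ) ^ (β₀ * l) ≤ γ ((2 : ℝ) ^ (k + l)) / γ ((2 : ℝ) ^ k) ∧
          γ ((2 : ℝ) ^ (k + l)) / γ ((2 : ℝ) ^ k) ≤ (2 : ℝ) ^ (β₁ * l)) ∧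
      ((∀ s > (0 : ℝ), iteratedDeriv 2 Γ s < 0) →
        (2 : ℝ) ^ (-(β₁ * l)) ≤ γ ((2 : ℝ) ^ (k + l)) / γ ((2 : ℝ) ^ k) ∧
          γ ((2 : ℝ) ^ (k + l)) / γ ((2 : ℝ) ^ k) ≤ (2 : ℝ) ^ (-(β₀ * l))) := by
  obtain ⟨A, hA, B, hB, hAB⟩ := hΓ.exists_bounds
  refine ⟨B⁻¹, inv_pos.2 hB, A⁻¹, inv_pos.2 hA, fun k l hl => ?_⟩
  obtain ⟨ha, hka⟩ := hinv₁ ((2 : ℝ) ^ k) (by positivity)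
  obtain ⟨hb, hkb⟩ := hinv₁ ((2 : ℝ) ^ (k + l)) (by positivity)
  set a := γ ((2 : ℝ) ^ k)
  set b := γ ((2 : ℝ) ^ (k + l))
  have hD : 0 ≤ l * Real.log 2 := mul_nonneg hl (Real.log_nonneg one_le_two)
  have hab : Real.log (deriv Γ (Real.exp (Real.log b))) -
      Real.log (deriv Γ (Real.exp (Real.log a))) = l * Real.log 2 := by
    rw [Real.exp_log ha, Real.exp_log hb, hka, hkb, Real.log_rpow two_pos,
      Real.log_rpow two_pos]
    ring
  refine ⟨fun hpos => ?_, fun hneg => ?_⟩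
  · rw [two_rpow_mul_le_div_iff ha hb, div_le_two_rpow_mul_iff ha hb]
    refine sub_mem_Icc_of_deriv_mem_Icc hA hΓ.hasDerivAt_log_deriv_exp (fun t => ?_) hD hab
    have h := hAB _ (Real.exp_pos t)
    rwa [abs_of_pos (div_pos (mul_pos (hpos _ (Real.exp_pos t)) (Real.exp_pos t))
      (hΓ.deriv_pos _ (Real.exp_pos t)))] at h
  · rw [← neg_mul, ← neg_mul, two_rpow_mul_le_div_iff ha hb, div_le_two_rpow_mul_iff ha hb]
    have h := sub_mem_Icc_of_deriv_mem_Icc (x := Real.log b) (y := Real.log a) hA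
      (fun t => (hΓ.hasDerivAt_log_deriv_exp t).fun_neg) (B := B) (fun t => ?_) hD
      (by linarith)
    · constructor <;> linarith [h.1, h.2]
    · have h := hAB _ (Real.exp_pos t)
      rwa [abs_of_neg (div_neg_of_neg_of_pos
        (mul_neg_of_neg_of_pos (hneg _ (Real.exp_pos t)) (Real.exp_pos t))
        (hΓ.deriv_pos _ (Real.exp_pos t)))] at h
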